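/- Let m, s, M ∈ ℝ satisfy m < s < M, M = s − 2m, and s² = −M·m − (M+m)·m. Let ℓ > 0 and let ψ : ℝ → ℝ be continuous and even with ψ(x) = s for |x| ≤ ℓ, ψ infinitely differentiable on (ℓ, ∞) with ψ'(x) < 0 there, ψ(x) → m as x → ∞, and (s − ψ(x))·ψ'(x)² = (M − ψ(x))·(ψ(x) − m)² for all x ∈ (ℓ, ∞). Set u(t,x) = ψ(x − s·t), u_x(t,x) = ψ'(x − s·t) (defined almost everywhere), and P(t,x) = s² − (1/2)·(s − ψ(x − s·t))². Then the energy conservation law fails weakly: there exists a test function Φ ∈ C_c^∞(ℝ × ℝ) such that ∬_{ℝ²} [ (u² + u_x²)·∂_tΦ + ( u·(u² + u_x²) − u³ + 2·P·u )·∂_xΦ ] dx dt ≠ 0. -/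

import Mathlib

open MeasureTheory Set Filter

/-- Near a cusp of the form `(s - ψ) ψ'² = F(ψ)` at `a`, the square of the slope is integrable. -/
theorem integrableOn_sq_slope_of_cusp {s a b : ℝ} {ψ ψ' F : ℝ → ℝ}
    (hcont : Continuous ψ) (hF : Continuous F) (ha : ψ a = s)
    (hderiv : ∀ x ∈ Ioi a, HasDerivAt ψ (ψ' x) x)
    (hneg : ∀ x ∈ Ioi a, ψ' x < 0)
    (hode : ∀ x ∈ Ioi a, (s - ψ x) * ψ' x ^ 2 = F (ψ x)) :
    IntegrableOn (fun x => ψ' x ^ 2) (Ioc a b) := by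
  have hanti : StrictAntiOn ψ (Ici a) := by
    refine strictAntiOn_of_deriv_neg (convex_Ici a) hcont.continuousOn fun x hx => ?_
    rw [interior_Ici] at hx
    rw [(hderiv x hx).deriv]
    exact hneg x hx
  have hlt : ∀ x ∈ Ioi a, 0 < s - ψ x := fun x hx => by
    have := hanti self_mem_Ici (Ioi_subset_Ici_self hx) hx
    linarith
  obtain ⟨K, hK⟩ := (isCompact_Icc (a := a) (b := b)).exists_bound_of_continuousOn
    (hF.comp hcont).continuousOn
  have hroot : ∀ x ∈ Ioo a b,
      HasDerivAt (fun y => √(s - ψ y)) (-ψ' x / (2 * √(s - ψ x))) x := fun x hx =>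
    ((hderiv x hx.1).const_sub s).sqrt (hlt x hx.1).ne'
  have hint : IntegrableOn (fun x => -ψ' x / (2 * √(s - ψ x))) (Ioc a b) := by
    refine intervalIntegral.integrableOn_deriv_of_nonneg (g := fun y => √(s - ψ y))
      (Continuous.continuousOn (by fun_prop)) hroot fun x hx => ?_
    have := hneg x hx.1
    exact div_nonneg (by linarith) (by positivity)
  refine (hint.const_mul (2 * √K)).mono' ?_ ?_
  · refine ((measurable_deriv ψ).pow_const 2).aestronglyMeasurable.congr ?_
    filter_upwards [ae_restrict_mem measurableSet_Ioc] with x hx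
    rw [(hderiv x hx.1).deriv]
  · filter_upwards [ae_restrict_mem measurableSet_Ioc] with x hx
    have hpos := hlt x hx.1
    have hr : 0 < √(s - ψ x) := Real.sqrt_pos.2 hpos
    have hn := hneg x hx.1
    have hbound : -ψ' x * √(s - ψ x) ≤ √K := by
      refine Real.le_sqrt_of_sq_le ?_
      have h1 := (le_abs_self _).trans (hK x (Ioc_subset_Icc_self hx))
      have h2 := hode x hx.1
      simp only [Function.comp] at h1
      rw [mul_pow, Real.sq_sqrt hpos.le]
      linarith
    rw [Real.norm_of_nonneg (sq_nonneg _)]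
    have heq : 2 * √K * (-ψ' x / (2 * √(s - ψ x))) = √K * -ψ' x / √(s - ψ x) := by
      field_simp
    rw [heq, le_div_iff₀ hr]
    nlinarith

/-- The integral of a compactly supported `η'` against a step function with a jump at `a`. -/
theorem integrable_and_integral_step_mul_deriv {η : ℝ → ℝ} (hη : ContDiff ℝ 1 η)
    (hηc : HasCompactSupport η) (a p q : ℝ) :
    Integrable (fun x => (if x ≤ a then p else q) * deriv η x) ∧
      ∫ x, (if x ≤ a then p else q) * deriv η x = (p - q) * η a := by
  have hd : Integrable (deriv η) :=
    (hη.continuous_deriv le_rfl).integrable_of_hasCompactSupport hηc.deriv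
  have h1 : EqOn (fun x => (if x ≤ a then p else q) * deriv η x)
      (fun x => p * deriv η x) (Iic a) := fun x hx => by
    simp only [if_pos (mem_Iic.1 hx)]
  have h2 : EqOn (fun x => (if x ≤ a then p else q) * deriv η x)
      (fun x => q * deriv η x) (Ioi a) := fun x hx => by
    simp only [if_neg (not_le.2 (mem_Ioi.1 hx))]
  have i1 : IntegrableOn (fun x => (if x ≤ a then p else q) * deriv η x) (Iic a) :=
    (integrableOn_congr_fun h1 measurableSet_Iic).2 (hd.const_mul p).integrableOn
  have i2 : IntegrableOn (fun x => (if x ≤ a then p else q) * deriv η x) (Ioi a) :=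
    (integrableOn_congr_fun h2 measurableSet_Ioi).2 (hd.const_mul q).integrableOn
  refine ⟨?_, ?_⟩
  · rw [← integrableOn_univ, ← Iic_union_Ioi (a := a)]
    exact i1.union i2
  · rw [← intervalIntegral.integral_Iic_add_Ioi i1 i2,
      setIntegral_congr_fun measurableSet_Iic h1, setIntegral_congr_fun measurableSet_Ioi h2,
      integral_const_mul, integral_const_mul, hηc.integral_Iic_deriv_eq hη,
      hηc.integral_Ioi_deriv_eq hη]
    ring

/-- A product of test functions in the time variable and in the moving variable `x - s t`
is a test function on the plane. -/
theorem contDiff_and_hasCompactSupport_mul_shear {χ η : ℝ → ℝ} {n : WithTop ℕ∞}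
    (hχ : ContDiff ℝ n χ) (hχc : HasCompactSupport χ)
    (hη : ContDiff ℝ n η) (hηc : HasCompactSupport η) (s : ℝ) :
    ContDiff ℝ n (fun p : ℝ × ℝ => χ p.1 * η (p.2 - s * p.1)) ∧
      HasCompactSupport (fun p : ℝ × ℝ => χ p.1 * η (p.2 - s * p.1)) := by
  refine ⟨by fun_prop, ?_⟩
  refine HasCompactSupport.intro (K := (fun p : ℝ × ℝ => (p.1, p.2 + s * p.1)) ''
    (tsupport χ ×ˢ tsupport η)) ((hχc.isCompact.prod hηc.isCompact).image (by fun_prop)) ?_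
  intro p hp
  by_contra hne
  exact hp ⟨(p.1, p.2 - s * p.1), ⟨subset_tsupport _ (left_ne_zero_of_mul hne),
    subset_tsupport _ (right_ne_zero_of_mul hne)⟩, by simp⟩

/-- The weak form of a conservation law `e_t + f_x = 0` for waves travelling at speed `s`,
tested against a product of a function of time and a function of the moving variable. -/
theorem integral_travelling_weak_form {χ η e f : ℝ → ℝ} (hχ : ContDiff ℝ 1 χ)
    (hχc : HasCompactSupport χ) (hη : Differentiable ℝ η) (s : ℝ)
    (he : Integrable (fun x => e x * η x))
    (hG : Integrable (fun x => (f x - s * e x) * deriv η x)) :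
    (∫ t : ℝ, ∫ x : ℝ,
        e (x - s * t) * deriv (fun τ => χ τ * η (x - s * τ)) t
          + f (x - s * t) * deriv (fun y => χ t * η (y - s * t)) x) =
      (∫ t, χ t) * ∫ x, (f x - s * e x) * deriv η x := by
  have hinner : ∀ t, (∫ x : ℝ,
        e (x - s * t) * deriv (fun τ => χ τ * η (x - s * τ)) t
          + f (x - s * t) * deriv (fun y => χ t * η (y - s * t)) x) =
      deriv χ t * (∫ x, e x * η x) + χ t * ∫ x, (f x - s * e x) * deriv η x := by
    intro t
    rw [← integral_const_mul, ← integral_const_mul,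
      ← integral_add (he.const_mul _) (hG.const_mul _),
      ← integral_sub_right_eq_self (fun x => deriv χ t * (e x * η x)
        + χ t * ((f x - s * e x) * deriv η x)) (s * t)]
    congr 1 with x
    have hx : HasDerivAt (fun y => χ t * η (y - s * t)) (χ t * deriv η (x - s * t)) x := by
      have h := (hη (x - s * t)).hasDerivAt.comp x ((hasDerivAt_id x).sub_const (s * t))
      rw [mul_one] at h
      exact h.const_mul (χ t)
    have ht : HasDerivAt (fun τ => χ τ * η (x - s * τ))
        (deriv χ t * η (x - s * t) + χ t * (deriv η (x - s * t) * -(s * 1))) t := by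
      have h := (hη (x - s * t)).hasDerivAt.comp t
        (((hasDerivAt_id t).const_mul s).const_sub x)
      exact ((hχ.differentiable one_ne_zero) t).hasDerivAt.mul h
    rw [hx.deriv, ht.deriv]
    ring
  have iχ : Integrable χ := hχ.continuous.integrable_of_hasCompactSupport hχc
  have iχ' : Integrable (deriv χ) :=
    (hχ.continuous_deriv le_rfl).integrable_of_hasCompactSupport hχc.deriv
  have hzero : ∫ t, deriv χ t = 0 := integral_eq_zero_of_hasDerivAt_of_integrable
    (fun t => ((hχ.differentiable one_ne_zero) t).hasDerivAt) iχ' iχ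
  simp_rw [hinner]
  rw [integral_add (iχ'.mul_const _) (iχ.mul_const _), integral_mul_const, integral_mul_const,
    hzero, zero_mul, zero_add]

/-- The decaying stumpon of the Camassa–Holm equation (a cuspon with decay, parameters
`m < s < M` with `M = s − 2m`, glued along a plateau of height `s` and half-width `ℓ`,
with traveling-wave constant `a = s²`) does not satisfy the energy conservation law
`(u² + u_x²)_t + (u(u² + u_x²))_x = (u³ − 2Pu)_x` in the weak sense: there is a test
function `Φ` for which the corresponding double integral does not vanish. -/
theorem decaying_stumpon_not_conservative (M m s ℓ : ℝ)
    (hms : m < s) (hsM : s < M) (hM : M = s - 2 * m)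
    (ha : s ^ 2 = -(M * m) - (M + m) * m)
    (hℓ : 0 < ℓ) (ψ ψ' : ℝ → ℝ)
    (hcont : Continuous ψ) (heven : ∀ x, ψ (-x) = ψ x)
    (hplat : ∀ x : ℝ, |x| ≤ ℓ → ψ x = s)
    (hsmooth : ContDiffOn ℝ (⊤ : ℕ∞) ψ (Ioi ℓ))
    (hderiv : ∀ x ∈ Ioi ℓ, HasDerivAt ψ (ψ' x) x)
    (hneg : ∀ x ∈ Ioi ℓ, ψ' x < 0)
    (hdecay : Tendsto ψ atTop (nhds m))
    (hode : ∀ x ∈ Ioi ℓ,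
      (s - ψ x) * (ψ' x) ^ 2 = (M - ψ x) * (ψ x - m) ^ 2)
    (hψ'plat : ∀ x : ℝ, |x| ≤ ℓ → ψ' x = 0)
    (hψ'odd : ∀ x, ψ' (-x) = -ψ' x) :
    ∃ Φ : ℝ → ℝ → ℝ,
      ContDiff ℝ (⊤ : ℕ∞) (fun p : ℝ × ℝ => Φ p.1 p.2) ∧
      HasCompactSupport (fun p : ℝ × ℝ => Φ p.1 p.2) ∧
      (∫ t : ℝ, ∫ x : ℝ,
        ((ψ (x - s * t)) ^ 2 + (ψ' (x - s * t)) ^ 2) * deriv (fun τ => Φ τ x) t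
          + (ψ (x - s * t) * ((ψ (x - s * t)) ^ 2 + (ψ' (x - s * t)) ^ 2)
              - (ψ (x - s * t)) ^ 3
              + 2 * (s ^ 2 - (1 / 2) * (s - ψ (x - s * t)) ^ 2) * ψ (x - s * t))
            * deriv (Φ t) x) ≠ 0 := by
  have hsm : s = -3 * m := by
    subst hM
    have h : (s - m) * (s + 3 * m) = 0 := by linarith
    rcases mul_eq_zero.1 h with h | h <;> linarith
  have hm : m < 0 := by linarith
  let χ : ContDiffBump (0 : ℝ) := ⟨1, 2, one_pos, one_lt_two⟩
  let η : ContDiffBump ℓ := ⟨ℓ / 2, ℓ, half_pos hℓ, half_lt_self hℓ⟩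
  have hχ : ∀ n : ℕ∞, ContDiff ℝ n χ := fun n => χ.contDiff
  have hη : ∀ n : ℕ∞, ContDiff ℝ n η := fun n => η.contDiff
  have hηsupp : tsupport η = Icc 0 (2 * ℓ) := by
    rw [η.tsupport_eq, Real.closedBall_eq_Icc]
    congr 1 <;> simp only [η] <;> ring
  have hηℓ : η ℓ = 1 := η.one_of_mem_closedBall (Metric.mem_closedBall_self η.rIn_pos.le)
  have hslope : IntegrableOn (fun x => ψ' x ^ 2) (Icc 0 (2 * ℓ)) := by
    rw [← Icc_union_Ioc_eq_Icc hℓ.le (by linarith : ℓ ≤ 2 * ℓ)]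
    refine IntegrableOn.union ?_ (integrableOn_sq_slope_of_cusp
      (F := fun y => (M - y) * (y - m) ^ 2) hcont (by fun_prop)
      (hplat ℓ (abs_of_pos hℓ).le) hderiv hneg hode)
    refine (integrableOn_congr_fun (g := fun _ => (0 : ℝ)) (fun x hx => ?_)
      measurableSet_Icc).2 integrableOn_zero
    simp [hψ'plat x (abs_le.2 ⟨by linarith [hx.1], hx.2⟩)]
  have he : Integrable (fun x => (ψ x ^ 2 + ψ' x ^ 2) * η x) := by
    rw [← integrableOn_iff_integrable_of_support_subset (s := Icc 0 (2 * ℓ))]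
    · exact (((hcont.pow 2).continuousOn.integrableOn_compact isCompact_Icc).add
        hslope).mul_continuousOn (hη 0).continuous.continuousOn isCompact_Icc
    · intro x hx
      rw [← hηsupp]
      exact subset_tsupport _ (right_ne_zero_of_mul hx)
  have hG : (fun x => (ψ x * (ψ x ^ 2 + ψ' x ^ 2) - ψ x ^ 3
      + 2 * (s ^ 2 - (1 / 2) * (s - ψ x) ^ 2) * ψ x - s * (ψ x ^ 2 + ψ' x ^ 2)) * deriv η x)
      = fun x => (if x ≤ ℓ then s ^ 3 else -(M * m ^ 2)) * deriv η x := by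
    ext x
    by_cases hx : deriv η x = 0
    · simp [hx]
    have hx0 : x ∈ Icc 0 (2 * ℓ) := hηsupp ▸ support_deriv_subset hx
    congr 1
    split_ifs with hxℓ
    · have habs : |x| ≤ ℓ := abs_le.2 ⟨by linarith [hx0.1], hxℓ⟩
      rw [hplat x habs, hψ'plat x habs]
      ring
    · have h := hode x (not_le.1 hxℓ)
      linear_combination (-1) * h + ψ x * ha - ψ x ^ 2 * hM
  obtain ⟨hint, hval⟩ := integrable_and_integral_step_mul_deriv (hη 1) η.hasCompactSupport ℓ
    (s ^ 3) (-(M * m ^ 2))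
  obtain ⟨hΦ, hΦc⟩ := contDiff_and_hasCompactSupport_mul_shear (hχ ⊤) χ.hasCompactSupport
    (hη ⊤) η.hasCompactSupport s
  refine ⟨fun t x => χ t * η (x - s * t), hΦ, hΦc, ?_⟩
  have key := integral_travelling_weak_form (hχ 1) χ.hasCompactSupport
    ((hη 1).differentiable one_ne_zero) s (e := fun x => ψ x ^ 2 + ψ' x ^ 2)
    (f := fun x => ψ x * (ψ x ^ 2 + ψ' x ^ 2) - ψ x ^ 3
      + 2 * (s ^ 2 - (1 / 2) * (s - ψ x) ^ 2) * ψ x) he (hG ▸ hint)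
  refine ne_of_eq_of_ne key ?_
  rw [hG, hval, hηℓ]
  have hχpos : 0 < ∫ t, χ t := χ.integral_pos
  have hjump : 0 < s ^ 3 - -(M * m ^ 2) := by
    have h1 : 0 < s := by linarith
    have h2 : 0 < M := by linarith
    have h3 := pow_pos h1 3
    have h4 := mul_nonneg h2.le (sq_nonneg m)
    linarith
  exact mul_ne_zero hχpos.ne' (by linarith)
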